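/- Let s : ℕ → ℝ be a positive antitone sequence with ∑_j s_j² < ∞, and set N(τ) := ∑'_j s_j²/(s_j²+τ). Let σ > 0, α, β ∈ (0,1), x_α := log(1/α), x_β := log(1/β), C*_{α,β} := 4√(x_β)+4√(2x_α), and let φ be a nonnegative nondecreasing function. Suppose a projection scheme produces, for each dimension m ∈ ℕ, quantities S_m ≥ 0, v_m ≥ 0 and a bias b_m ≥ 0 satisfying the robustness/Bernstein/quasi-optimality/degree-of-approximation bounds: S_m² ≤ C_r²·(D_R²/C_B²)·σ²·N(s_m²)/s_m², v_m² ≤ (D_R²/C_B²)·σ²/s_m², and b_m ≤ D_Q·C_D·φ(s_{m+1}²), for positive constants C_r, D_R, C_B, D_Q, C_D. If m_* ∈ ℕ satisfies φ²(s_{m_*}²) ≥ σ²·√(N(s_{m_*}²))/s_{m_*}², then inf_{m} ( C*_{α,β}·S_m·v_m + (4x_α+8x_β)·v_m² + b_m² ) ≤ ( C*_{α,β}·(D_R²/C_B²)·C_r + (4x_α+8x_β)·(D_R²/C_B²)/√(N(s_{m_*}²)) + D_Q²·C_D² )·φ²(s_{m_*}²). (This is the main non-asymptotic separation-radius bound for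 tests based on projection schemes, evaluated at the maximal dimension m_* for which the smoothness dominates the stochastic term.) -/

import Mathlib

/-- The effective dimension of a square-summable positive sequence is positive. -/
theorem tsum_sq_div_sq_add_pos {s : ℕ → ℝ} (hpos : ∀ j, 0 < s j)
    (hsum : Summable fun j => s j ^ 2) {τ : ℝ} (hτ : 0 < τ) :
    0 < ∑' j, s j ^ 2 / (s j ^ 2 + τ) := by
  have hterm : ∀ j, 0 < s j ^ 2 / (s j ^ 2 + τ) := fun j => by
    have := hpos j
    positivity
  have hsummable : Summable fun j => s j ^ 2 / (s j ^ 2 + τ) := by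
    refine Summable.of_nonneg_of_le (fun j => (hterm j).le) (fun j => ?_) (hsum.div_const τ)
    exact div_le_div_of_nonneg_left (sq_nonneg _) hτ (le_add_of_nonneg_left (sq_nonneg _))
  exact hsummable.tsum_pos (fun j => (hterm j).le) 0 (hterm 0)

/-- Main non-asymptotic separation-radius bound for tests based on projection
schemes: if for each dimension `m` the variance, weak variance and bias satisfy
`S_m² ≤ C_r² (D_R²/C_B²) σ² N(s_m²)/s_m²`, `v_m² ≤ (D_R²/C_B²) σ²/s_m²` and
`b_m ≤ D_Q C_D φ(s_{m+1}²)`, and `m_*` satisfies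
`φ²(s_{m_*}²) ≥ σ² √(N(s_{m_*}²))/s_{m_*}²`, then
`inf_m (C* S_m v_m + (4x_α+8x_β) v_m² + b_m²) ≤
  (C* (D_R²/C_B²) C_r + (4x_α+8x_β)(D_R²/C_B²)/√(N(s_{m_*}²)) + D_Q² C_D²) φ²(s_{m_*}²)`. -/
theorem stmt_19
    (s : ℕ → ℝ) (hpos : ∀ j, 0 < s j) (hant : Antitone s)
    (hsum : Summable fun j => s j ^ 2)
    (N : ℝ → ℝ) (hN : ∀ τ, N τ = ∑' j, s j ^ 2 / (s j ^ 2 + τ))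
    (σ : ℝ) (hσ : 0 < σ)
    (α β : ℝ) (hα : α ∈ Set.Ioo (0 : ℝ) 1) (hβ : β ∈ Set.Ioo (0 : ℝ) 1)
    (xα xβ Cab : ℝ) (hxα : xα = Real.log (1 / α)) (hxβ : xβ = Real.log (1 / β))
    (hCab : Cab = 4 * Real.sqrt xβ + 4 * Real.sqrt (2 * xα))
    (φ : ℝ → ℝ) (hφ0 : ∀ t, 0 ≤ φ t) (hφmono : Monotone φ)
    (Cr DR CB DQ CD : ℝ)
    (hCr : 0 < Cr) (hDR : 0 < DR) (hCB : 0 < CB) (hDQ : 0 < DQ) (hCD : 0 < CD)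
    (S v b : ℕ → ℝ) (hSpos : ∀ m, 0 ≤ S m) (hvpos : ∀ m, 0 ≤ v m)
    (hbpos : ∀ m, 0 ≤ b m)
    (hS : ∀ m, S m ^ 2 ≤ Cr ^ 2 * (DR ^ 2 / CB ^ 2) * σ ^ 2 * N (s m ^ 2) / s m ^ 2)
    (hv : ∀ m, v m ^ 2 ≤ (DR ^ 2 / CB ^ 2) * σ ^ 2 / s m ^ 2)
    (hb : ∀ m, b m ≤ DQ * CD * φ (s (m + 1) ^ 2))
    (ms : ℕ)
    (hms : σ ^ 2 * Real.sqrt (N (s ms ^ 2)) / s ms ^ 2 ≤ φ (s ms ^ 2) ^ 2) :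
    (⨅ m : ℕ, (Cab * S m * v m + (4 * xα + 8 * xβ) * v m ^ 2 + b m ^ 2)) ≤
      (Cab * (DR ^ 2 / CB ^ 2) * Cr
        + (4 * xα + 8 * xβ) * (DR ^ 2 / CB ^ 2) / Real.sqrt (N (s ms ^ 2))
        + DQ ^ 2 * CD ^ 2) * φ (s ms ^ 2) ^ 2 := by
  have hxα0 : 0 ≤ xα := hxα ▸ Real.log_nonneg (one_le_one_div hα.1 hα.2.le)
  have hxβ0 : 0 ≤ xβ := hxβ ▸ Real.log_nonneg (one_le_one_div hβ.1 hβ.2.le)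
  have hCab0 : 0 ≤ Cab := by rw [hCab]; positivity
  have hNpos : 0 < N (s ms ^ 2) := by
    rw [hN]
    exact tsum_sq_div_sq_add_pos hpos hsum (pow_pos (hpos ms) 2)
  have hbdd : BddBelow (Set.range fun m : ℕ =>
      Cab * S m * v m + (4 * xα + 8 * xβ) * v m ^ 2 + b m ^ 2) := by
    refine ⟨0, ?_⟩
    rintro _ ⟨m, rfl⟩
    have := hSpos m
    have := hvpos m
    positivity
  refine (ciInf_le hbdd ms).trans ?_
  have hspos := hpos ms
  have hSm := hS ms
  have hvm := hv ms
  have hS0 := hSpos ms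
  have hv0 := hvpos ms
  obtain ⟨n, hn⟩ : ∃ n, n = √(N (s ms ^ 2)) := ⟨_, rfl⟩
  obtain ⟨K, hK⟩ : ∃ K, K = DR ^ 2 / CB ^ 2 := ⟨_, rfl⟩
  obtain ⟨A, hA⟩ : ∃ A, A = σ ^ 2 / s ms ^ 2 := ⟨_, rfl⟩
  have hn0 : 0 < n := hn ▸ Real.sqrt_pos.2 hNpos
  have hK0 : 0 < K := by rw [hK]; positivity
  have hA0 : 0 < A := by rw [hA]; positivity
  have hNn : N (s ms ^ 2) = n ^ 2 := by rw [hn, Real.sq_sqrt hNpos.le]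
  rw [← hn] at hms ⊢
  rw [← hK] at hSm hvm ⊢
  rw [hNn] at hSm
  replace hSm : S ms ^ 2 ≤ Cr ^ 2 * K * A * n ^ 2 := hSm.trans_eq (by rw [hA]; ring)
  replace hvm : v ms ^ 2 ≤ K * A := hvm.trans_eq (by rw [hA]; ring)
  have hAn : A * n ≤ φ (s ms ^ 2) ^ 2 := le_trans (by rw [hA]; exact le_of_eq (by ring)) hms
  have hSv : S ms * v ms ≤ K * Cr * φ (s ms ^ 2) ^ 2 :=
    calc S ms * v ms ≤ K * Cr * (A * n) := by
          refine le_of_pow_le_pow_left₀ two_ne_zero (by positivity) ?_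
          calc (S ms * v ms) ^ 2 = S ms ^ 2 * v ms ^ 2 := by ring
            _ ≤ (Cr ^ 2 * K * A * n ^ 2) * (K * A) := by gcongr
            _ = (K * Cr * (A * n)) ^ 2 := by ring
      _ ≤ K * Cr * φ (s ms ^ 2) ^ 2 := by gcongr
  have hvv : v ms ^ 2 ≤ K / n * φ (s ms ^ 2) ^ 2 :=
    calc v ms ^ 2 ≤ K * A := hvm
      _ = K / n * (A * n) := by field_simp
      _ ≤ K / n * φ (s ms ^ 2) ^ 2 := by gcongr
  have hbb : b ms ^ 2 ≤ (DQ * CD * φ (s ms ^ 2)) ^ 2 := by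
    refine pow_le_pow_left₀ (hbpos ms) ((hb ms).trans ?_) 2
    refine mul_le_mul_of_nonneg_left (hφmono ?_) (by positivity)
    exact pow_le_pow_left₀ (hpos _).le (hant ms.le_succ) 2
  calc Cab * S ms * v ms + (4 * xα + 8 * xβ) * v ms ^ 2 + b ms ^ 2
      = Cab * (S ms * v ms) + (4 * xα + 8 * xβ) * v ms ^ 2 + b ms ^ 2 := by ring
    _ ≤ Cab * (K * Cr * φ (s ms ^ 2) ^ 2) + (4 * xα + 8 * xβ) * (K / n * φ (s ms ^ 2) ^ 2)
        + (DQ * CD * φ (s ms ^ 2)) ^ 2 := by gcongr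
    _ = _ := by ring
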